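/- arXiv:2512.15205 — 7 statements merged into one kernel-verified Lean document; each statement's English description precedes it below -/
import Mathlib

section
/- Let φ̃ : ℝ^d → ℝ be differentiable and μ-strongly convex with μ > 0, let φ : ℝ^d → ℝ be differentiable and convex, and let ψ : ℝ^d → ℝ be convex. If x* is a global minimizer of φ + ψ and x̃* is a global minimizer of φ̃ + ψ, then μ‖x* − x̃*‖ ≤ ‖∇φ̃(x*) − ∇φ(x*)‖. -/
open scoped RealInnerProductSpace

/-- First-order optimality condition for the minimization of a sum of a differentiable function
and a convex function. -/
theorem inner_gradient_add_sub_nonneg_of_isMin_add {E : Type*} [NormedAddCommGroup E]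
    [InnerProductSpace ℝ E] [CompleteSpace E] {f g : E → ℝ} {a : E}
    (hf : DifferentiableAt ℝ f a) (hg : ConvexOn ℝ Set.univ g)
    (hmin : ∀ x, f a + g a ≤ f x + g x) (x : E) :
    0 ≤ ⟪gradient f a, x - a⟫ + (g x - g a) := by
  have hline : HasLineDerivAt ℝ f ⟪gradient f a, x - a⟫ a (x - a) := by
    simpa using hf.hasGradientAt.hasFDerivAt.hasLineDerivAt (x - a)
  have hlim := hline.tendsto_slope_zero_right
  refine ge_of_tendsto (hlim.add_const (g x - g a)) ?_
  filter_upwards [Ioo_mem_nhdsGT (zero_lt_one' ℝ)] with t ht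
  have hconv := hg.2 (Set.mem_univ a) (Set.mem_univ x) (sub_nonneg.2 ht.2.le) ht.1.le
    (sub_add_cancel 1 t)
  have hpoint : (1 - t) • a + t • x = a + t • (x - a) := by module
  rw [hpoint, smul_eq_mul, smul_eq_mul] at hconv
  have hcmp := hmin (a + t • (x - a))
  have hslope : t⁻¹ • (f (a + t • (x - a)) - f a) + (g x - g a)
      = t⁻¹ * (f (a + t • (x - a)) - f a + t * (g x - g a)) := by
    have := ht.1.ne'
    simp only [smul_eq_mul]
    field_simp
  rw [hslope]
  exact mul_nonneg (inv_nonneg.2 ht.1.le) (by linarith)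

/-- If `x*` minimizes `φ + ψ` and `x̃*` minimizes `φ̃ + ψ`, where `φ̃` is
differentiable and `μ`-strongly convex, `φ` is differentiable convex and `ψ` is convex,
then `μ‖x* − x̃*‖ ≤ ‖∇φ̃(x*) − ∇φ(x*)‖`. -/
theorem minimizer_strongly_convex_perturbation (d : ℕ) (μ : ℝ) (hμ : 0 < μ)
    (φ φt ψ : EuclideanSpace ℝ (Fin d) → ℝ)
    (hφtdiff : Differentiable ℝ φt)
    (hφtsc : ∀ x x' : EuclideanSpace ℝ (Fin d),
      φt x' + ⟪gradient φt x', x - x'⟫ + μ / 2 * ‖x - x'‖ ^ 2 ≤ φt x)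
    (hφdiff : Differentiable ℝ φ) (hφconv : ConvexOn ℝ Set.univ φ)
    (hψconv : ConvexOn ℝ Set.univ ψ)
    (xstar xtstar : EuclideanSpace ℝ (Fin d))
    (hxstar : ∀ x, φ xstar + ψ xstar ≤ φ x + ψ x)
    (hxtstar : ∀ x, φt xtstar + ψ xtstar ≤ φt x + ψ x) :
    μ * ‖xstar - xtstar‖ ≤ ‖gradient φt xstar - gradient φ xstar‖ := by
  have h₁ := inner_gradient_add_sub_nonneg_of_isMin_add (hφdiff xstar) hψconv hxstar xtstar
  have h₂ := inner_gradient_add_sub_nonneg_of_isMin_add (hφtdiff xtstar) hψconv hxtstar xstar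
  have h₃ := hφtsc xstar xtstar
  have h₄ := hφtsc xtstar xstar
  rw [← neg_sub xstar xtstar, inner_neg_right] at h₁ h₄
  rw [norm_neg] at h₄
  have hcs := real_inner_le_norm (gradient φt xstar - gradient φ xstar) (xstar - xtstar)
  rw [inner_sub_left] at hcs
  rcases (norm_nonneg (xstar - xtstar)).eq_or_lt with h | h
  · rw [← h, mul_zero]
    exact norm_nonneg _
  · refine le_of_mul_le_mul_right ?_ h
    linarith
end

section
/- Let ν and ν' be probability measures on ℝ^{d_y}, let x* be a global minimizer of x ↦ ∫ ℓ(x;y) dν(y) + ψ(x) and x'* a global minimizer of x ↦ ∫ ℓ(x;y) dν'(y) + ψ(x). Then for every probability measure π on ℝ^{d_y} × ℝ^{d_y} whose first marginal is ν and whose second marginal is ν' and for which (y,y') ↦ ‖y − y'‖ is π-integrable, one has ‖x* − x'*‖ ≤ (L₁₁/μ) ∫ ‖y − y'‖ dπ(y,y'). In particular, ‖x* − x'*‖ is at most (L₁₁/μ) times the Wasserstein-1 distance between ν and ν'. -/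
open MeasureTheory

open scoped RealInnerProductSpace

/-- First-order strong convexity makes the (sub)gradient `g` strongly monotone. -/
theorem strongly_monotone_of_strong_convexity {E : Type*} [NormedAddCommGroup E]
    [InnerProductSpace ℝ E] {f : E → ℝ} {g : E → E} {μ : ℝ}
    (h : ∀ x x', f x' + ⟪g x', x - x'⟫ + μ / 2 * ‖x - x'‖ ^ 2 ≤ f x) (u v : E) :
    μ * ‖u - v‖ ^ 2 ≤ ⟪g u - g v, u - v⟫ := by
  have h1 := h u v
  have h2 := h v u
  rw [← neg_sub u v, inner_neg_right, norm_neg] at h2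
  rw [inner_sub_left]
  linarith

/-- Moving `a` and `b` towards each other by a fraction `t` decreases `f₁ a + f₂ b` at a
linear rate, up to the discrepancy `K` between the gradients of `f₁` and `f₂`. -/
theorem le_decrease_of_strong_convexity {E : Type*} [NormedAddCommGroup E]
    [InnerProductSpace ℝ E] {f₁ f₂ : E → ℝ} {g₁ g₂ : E → E} {μ K : ℝ} (hμ : 0 ≤ μ)
    (h₁ : ∀ x x', f₁ x' + ⟪g₁ x', x - x'⟫ + μ / 2 * ‖x - x'‖ ^ 2 ≤ f₁ x)
    (h₂ : ∀ x x', f₂ x' + ⟪g₂ x', x - x'⟫ + μ / 2 * ‖x - x'‖ ^ 2 ≤ f₂ x)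
    (hK : ∀ x, ‖g₁ x - g₂ x‖ ≤ K) (a b : E) {t : ℝ} (ht : 0 ≤ t) (ht' : t < 1 / 2) :
    t * (μ * (1 - 2 * t) * ‖a - b‖ ^ 2 - K * ‖a - b‖) ≤
      (f₁ a - f₁ ((1 - t) • a + t • b)) + (f₂ b - f₂ (t • a + (1 - t) • b)) := by
  set u := (1 - t) • a + t • b with hu
  set v := t • a + (1 - t) • b with hv
  have hau : a - u = t • (a - b) := by rw [hu]; module
  have hbv : b - v = -(t • (a - b)) := by rw [hv]; module
  have huv : u - v = (1 - 2 * t) • (a - b) := by rw [hu, hv]; module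
  have hs : 0 < 1 - 2 * t := by linarith
  have ha := h₁ a u
  have hb := h₂ b v
  rw [hau, inner_smul_right] at ha
  rw [hbv, inner_neg_right, inner_smul_right] at hb
  have hmono := strongly_monotone_of_strong_convexity h₁ u v
  rw [huv, norm_smul, Real.norm_of_nonneg hs.le, inner_smul_right] at hmono
  have hmono' : μ * (1 - 2 * t) * ‖a - b‖ ^ 2 ≤ ⟪g₁ u - g₁ v, a - b⟫ :=
    le_of_mul_le_mul_left (by linarith) hs
  have hdisc : -(K * ‖a - b‖) ≤ ⟪g₁ v - g₂ v, a - b⟫ :=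
    (neg_le_neg (mul_le_mul_of_nonneg_right (hK v) (norm_nonneg _))).trans
      (abs_le.mp (abs_real_inner_le_norm _ _)).1
  have hsum : μ * (1 - 2 * t) * ‖a - b‖ ^ 2 - K * ‖a - b‖ ≤
      ⟪g₁ u, a - b⟫ - ⟪g₂ v, a - b⟫ := by
    rw [inner_sub_left] at hmono' hdisc
    linarith
  have hscaled := mul_le_mul_of_nonneg_left hsum ht
  have hau_nonneg : 0 ≤ μ / 2 * ‖t • (a - b)‖ ^ 2 := by positivity
  rw [norm_neg] at hb
  linarith

/-- Drift of the optimizer in terms of couplings: if `x*` minimizes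
`x ↦ ∫ ℓ(x;y) dν(y) + ψ(x)` and `x'*` minimizes `x ↦ ∫ ℓ(x;y) dν'(y) + ψ(x)`, where
`ℓ(·;y)` is differentiable and `μ`-strongly convex, its gradient is `L`-Lipschitz in `x`
and `L₁₁`-Lipschitz in `y`, then for every coupling `π` of `ν` and `ν'` with integrable
cost, `‖x* − x'*‖ ≤ (L₁₁/μ) ∫ ‖y − y'‖ dπ(y,y')`. -/
theorem optimizer_drift_coupling (d dy : ℕ) (μ : ℝ) (hμ : 0 < μ) (L L₁₁ : NNReal)
    (ν ν' : Measure (EuclideanSpace ℝ (Fin dy)))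
    [IsProbabilityMeasure ν] [IsProbabilityMeasure ν']
    (ℓ : EuclideanSpace ℝ (Fin d) → EuclideanSpace ℝ (Fin dy) → ℝ)
    (hmeas : Measurable fun p : EuclideanSpace ℝ (Fin d) × EuclideanSpace ℝ (Fin dy) =>
      ℓ p.1 p.2)
    (hdiff : ∀ y, Differentiable ℝ fun x => ℓ x y)
    (hsc : ∀ y, ∀ x x' : EuclideanSpace ℝ (Fin d),
      ℓ x' y + ⟪gradient (fun z => ℓ z y) x', x - x'⟫ + μ / 2 * ‖x - x'‖ ^ 2 ≤ ℓ x y)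
    (hlipx : ∀ y, LipschitzWith L fun x => gradient (fun z => ℓ z y) x)
    (hlipy : ∀ x : EuclideanSpace ℝ (Fin d),
      LipschitzWith L₁₁ fun y => gradient (fun z => ℓ z y) x)
    (hint : ∀ x, Integrable (fun y => ℓ x y) ν ∧ Integrable (fun y => ℓ x y) ν')
    (hintg : ∀ x, Integrable (fun y => ‖gradient (fun z => ℓ z y) x‖) ν ∧
      Integrable (fun y => ‖gradient (fun z => ℓ z y) x‖) ν')
    (ψ : EuclideanSpace ℝ (Fin d) → ℝ) (hψ : ConvexOn ℝ Set.univ ψ)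
    (xstar xstar' : EuclideanSpace ℝ (Fin d))
    (hxstar : ∀ x, (∫ y, ℓ xstar y ∂ν) + ψ xstar ≤ (∫ y, ℓ x y ∂ν) + ψ x)
    (hxstar' : ∀ x, (∫ y, ℓ xstar' y ∂ν') + ψ xstar' ≤ (∫ y, ℓ x y ∂ν') + ψ x) :
    ∀ π : Measure (EuclideanSpace ℝ (Fin dy) × EuclideanSpace ℝ (Fin dy)),
      IsProbabilityMeasure π →
      π.map Prod.fst = ν → π.map Prod.snd = ν' →
      Integrable (fun p => ‖p.1 - p.2‖) π →
      ‖xstar - xstar'‖ ≤ (L₁₁ / μ) * ∫ p, ‖p.1 - p.2‖ ∂π := by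
  intro π _ hfst hsnd hcost
  have hmp₁ : MeasurePreserving Prod.fst π ν := ⟨measurable_fst, hfst⟩
  have hmp₂ : MeasurePreserving Prod.snd π ν' := ⟨measurable_snd, hsnd⟩
  have hint₁ (x) : Integrable (fun p => ℓ x p.1) π := hmp₁.integrable_comp_of_integrable (hint x).1
  have hint₂ (x) : Integrable (fun p => ℓ x p.2) π := hmp₂.integrable_comp_of_integrable (hint x).2
  have heq₁ (x) : ∫ y, ℓ x y ∂ν = ∫ p, ℓ x p.1 ∂π := by
    rw [← hfst]
    exact integral_map measurable_fst.aemeasurable (hfst ▸ (hint x).1.aestronglyMeasurable)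
  have heq₂ (x) : ∫ y, ℓ x y ∂ν' = ∫ p, ℓ x p.2 ∂π := by
    rw [← hsnd]
    exact integral_map measurable_snd.aemeasurable (hsnd ▸ (hint x).2.aestronglyMeasurable)
  set D := ‖xstar - xstar'‖ with hD
  set C := ∫ p, ‖p.1 - p.2‖ ∂π
  have key : ∀ t ∈ Set.Ioo (0 : ℝ) (1 / 2), μ * (1 - 2 * t) * D ^ 2 - L₁₁ * C * D ≤ 0 := by
    rintro t ⟨ht, ht'⟩
    set u := (1 - t) • xstar + t • xstar'
    set v := t • xstar + (1 - t) • xstar'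
    have hψu : ψ u ≤ (1 - t) * ψ xstar + t * ψ xstar' :=
      hψ.2 trivial trivial (by linarith) ht.le (by ring)
    have hψv : ψ v ≤ t * ψ xstar + (1 - t) * ψ xstar' :=
      hψ.2 trivial trivial ht.le (by linarith) (by ring)
    have hoptu := hxstar u
    have hoptv := hxstar' v
    rw [heq₁, heq₁] at hoptu
    rw [heq₂, heq₂] at hoptv
    have hmono := integral_mono (μ := π)
      (f := fun p => t * (μ * (1 - 2 * t) * D ^ 2 - L₁₁ * ‖p.1 - p.2‖ * D))
      (g := fun p => (ℓ xstar p.1 - ℓ u p.1) + (ℓ xstar' p.2 - ℓ v p.2))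
      (((integrable_const _).sub ((hcost.const_mul _).mul_const _)).const_mul _)
      (((hint₁ _).sub (hint₁ _)).add ((hint₂ _).sub (hint₂ _)))
      (fun p => le_decrease_of_strong_convexity hμ.le (hsc p.1) (hsc p.2)
        (fun x => by simpa only [dist_eq_norm] using (hlipy x).dist_le_mul p.1 p.2)
        xstar xstar' ht.le ht')
    have hleft : ∫ p, t * (μ * (1 - 2 * t) * D ^ 2 - L₁₁ * ‖p.1 - p.2‖ * D) ∂π =
        t * (μ * (1 - 2 * t) * D ^ 2 - L₁₁ * C * D) := by
      rw [integral_const_mul, integral_sub (integrable_const _)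
        ((hcost.const_mul _).mul_const _), integral_const, probReal_univ, one_smul,
        integral_mul_const, integral_const_mul]
    have hright : ∫ p, ((ℓ xstar p.1 - ℓ u p.1) + (ℓ xstar' p.2 - ℓ v p.2)) ∂π =
        (∫ p, ℓ xstar p.1 ∂π - ∫ p, ℓ u p.1 ∂π) +
          (∫ p, ℓ xstar' p.2 ∂π - ∫ p, ℓ v p.2 ∂π) := by
      rw [← integral_sub (hint₁ _) (hint₁ _), ← integral_sub (hint₂ _) (hint₂ _)]
      exact integral_add ((hint₁ _).sub (hint₁ _)) ((hint₂ _).sub (hint₂ _))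
    rw [hleft, hright] at hmono
    exact nonpos_of_mul_nonpos_right (by linarith) ht
  have hlim : μ * D ^ 2 - L₁₁ * C * D ≤ 0 := by
    have hcont : Continuous fun t : ℝ => μ * (1 - 2 * t) * D ^ 2 - L₁₁ * C * D := by fun_prop
    have htends := (hcont.tendsto 0).mono_left (nhdsWithin_le_nhds (s := Set.Ioi 0))
    simp only [mul_zero, sub_zero, mul_one] at htends
    exact le_of_tendsto htends (Filter.mem_of_superset
      (Ioo_mem_nhdsGT (by norm_num : (0 : ℝ) < 1 / 2)) key)
  have hC_nonneg : 0 ≤ C := integral_nonneg fun _ => norm_nonneg _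
  rcases (norm_nonneg (xstar - xstar')).eq_or_lt with h0 | hpos
  · rw [hD, ← h0]
    positivity
  · rw [div_mul_eq_mul_div, le_div_iff₀ hμ]
    exact le_of_mul_le_mul_right (by rw [← hD]; linarith) hpos
end

section
/- Let (P_k)_{k≥0} be a sequence of probability measures on ℝ^{d_y}, and for each k let x*_k be a global minimizer of x ↦ ∫ ℓ(x;y) dP_k(y) + ψ(x). Let α ∈ ℝⁿ with ∑_{i=1}^n αᵢ = 1, and suppose ε-sensitivity with step h > 0: for each k there exists a probability measure π_k on ℝ^{d_y} × ℝ^{d_y} with first marginal P_k and second marginal P_{k+1} satisfying ∫ ‖y − y'‖ dπ_k(y,y') ≤ εh. Then for every k ≥ n, ‖∑_{i=1}^n αᵢ x*_{k−i} − x*_k‖ ≤ (L₁₁/μ) εh ∑_{j=1}^n |∑_{i=j}^n αᵢ|. -/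
open MeasureTheory

open scoped RealInnerProductSpace

/-- A first-order strong convexity inequality yields the zeroth-order one. -/
lemma strongConvexOn_of_gradient_le {E : Type*} [NormedAddCommGroup E] [InnerProductSpace ℝ E]
    {f : E → ℝ} {g : E → E} {m : ℝ}
    (hf : ∀ x x', f x' + ⟪g x', x - x'⟫ + m / 2 * ‖x - x'‖ ^ 2 ≤ f x) :
    StrongConvexOn Set.univ m f := by
  refine ⟨convex_univ, fun x _ y _ a b ha hb hab => ?_⟩
  obtain rfl : b = 1 - a := by linarith
  have hx : x - (a • x + (1 - a) • y) = (1 - a) • (x - y) := by module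
  have hy : y - (a • x + (1 - a) • y) = (-a) • (x - y) := by module
  have h₁ := hf x (a • x + (1 - a) • y)
  have h₂ := hf y (a • x + (1 - a) • y)
  rw [hx, inner_smul_right, norm_smul, mul_pow, Real.norm_eq_abs, sq_abs] at h₁
  rw [hy, inner_smul_right, norm_smul, mul_pow, Real.norm_eq_abs, sq_abs] at h₂
  have h₃ := mul_le_mul_of_nonneg_left h₁ ha
  have h₄ := mul_le_mul_of_nonneg_left h₂ hb
  simp only [smul_eq_mul]
  linarith

/-- Integrating a family of strongly convex functions against a probability measure preserves
strong convexity. -/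
lemma StrongConvexOn.integral {E Y : Type*} [NormedAddCommGroup E] [NormedSpace ℝ E]
    [MeasurableSpace Y] {P : Measure Y} [IsProbabilityMeasure P] {f : E → Y → ℝ} {m : ℝ}
    (hf : ∀ y, StrongConvexOn Set.univ m fun x => f x y) (hint : ∀ x, Integrable (f x) P) :
    StrongConvexOn Set.univ m fun x => ∫ y, f x y ∂P := by
  refine ⟨convex_univ, fun x hx y hy a b ha hb hab => ?_⟩
  have hi : Integrable (fun z => a * f x z + b * f y z) P :=
    ((hint x).const_mul a).add ((hint y).const_mul b)
  calc ∫ z, f (a • x + b • y) z ∂P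
      ≤ ∫ z, (a * f x z + b * f y z - a * b * (m / 2 * ‖x - y‖ ^ 2)) ∂P :=
        integral_mono (hint _) (hi.sub (integrable_const _))
          fun z => (hf z).2 hx hy ha hb hab
    _ = _ := by
        rw [integral_sub hi (integrable_const _),
          integral_add ((hint x).const_mul a) ((hint y).const_mul b),
          integral_const_mul, integral_const_mul]
        simp

/-- Adding a convex function preserves strong convexity. -/
lemma StrongConvexOn.add_convexOn {E : Type*} [NormedAddCommGroup E] [NormedSpace ℝ E]
    {s : Set E} {f g : E → ℝ} {m : ℝ} (hf : StrongConvexOn s m f) (hg : ConvexOn ℝ s g) :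
    StrongConvexOn s m (f + g) :=
  (UniformConvexOn.add hf (uniformConvexOn_zero.2 hg)).mono (add_zero _).ge

/-- Quadratic growth of a strongly convex function away from a minimizer. -/
lemma StrongConvexOn.add_sq_norm_le_of_forall_le {E : Type*} [NormedAddCommGroup E]
    [NormedSpace ℝ E] {f : E → ℝ} {m : ℝ} (hf : StrongConvexOn Set.univ m f) {a : E}
    (ha : ∀ x, f a ≤ f x) (b : E) : f a + m / 2 * ‖a - b‖ ^ 2 ≤ f b := by
  have key : ∀ t ∈ Set.Ioo (0 : ℝ) 1, f a + (1 - t) * (m / 2 * ‖a - b‖ ^ 2) ≤ f b := by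
    rintro t ⟨ht₀, ht₁⟩
    have h₁ := hf.2 (Set.mem_univ a) (Set.mem_univ b) (sub_nonneg.2 ht₁.le) ht₀.le (by ring)
    have h₂ := (ha _).trans h₁
    simp only [smul_eq_mul] at h₂
    refine le_of_mul_le_mul_left ?_ ht₀
    linarith
  have hlim : Filter.Tendsto (fun t : ℝ => f a + (1 - t) * (m / 2 * ‖a - b‖ ^ 2))
      (nhdsWithin 0 (Set.Ioi 0)) (nhds (f a + (1 - 0) * (m / 2 * ‖a - b‖ ^ 2))) :=
    (Continuous.tendsto (by fun_prop) 0).mono_left nhdsWithin_le_nhds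
  have := le_of_tendsto hlim
    (Filter.mem_of_superset (Ioo_mem_nhdsGT one_pos) key)
  simpa using this

/-- If the gradient in `x` is `K`-Lipschitz in `y`, the mixed second difference of `ℓ` is bounded
by `K` times the product of the increments. -/
lemma sub_sub_sub_le_of_lipschitz_gradient {E Y : Type*} [NormedAddCommGroup E]
    [InnerProductSpace ℝ E] [CompleteSpace E] [SeminormedAddCommGroup Y] {ℓ : E → Y → ℝ}
    {K : NNReal} (hdiff : ∀ y, Differentiable ℝ fun x => ℓ x y)
    (hlip : ∀ x, LipschitzWith K fun y => gradient (fun z => ℓ z y) x) (a b : E) (y y' : Y) :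
    (ℓ b y - ℓ a y) - (ℓ b y' - ℓ a y') ≤ K * ‖b - a‖ * ‖y - y'‖ := by
  have hderiv : ∀ x ∈ Set.univ, HasFDerivWithinAt (fun x => ℓ x y - ℓ x y')
      (InnerProductSpace.toDual ℝ E (gradient (fun z => ℓ z y) x)
        - InnerProductSpace.toDual ℝ E (gradient (fun z => ℓ z y') x)) Set.univ x := fun x _ =>
    ((hdiff y x).hasGradientAt.hasFDerivAt.sub
      (hdiff y' x).hasGradientAt.hasFDerivAt).hasFDerivWithinAt
  have hbound : ∀ x ∈ Set.univ, ‖InnerProductSpace.toDual ℝ E (gradient (fun z => ℓ z y) x)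
        - InnerProductSpace.toDual ℝ E (gradient (fun z => ℓ z y') x)‖ ≤ K * ‖y - y'‖ := by
    intro x _
    rw [← map_sub, LinearIsometryEquiv.norm_map]
    exact (hlip x).norm_sub_le y y'
  have h := convex_univ.norm_image_sub_le_of_norm_hasFDerivWithin_le hderiv hbound
    (Set.mem_univ a) (Set.mem_univ b)
  have h' := (Real.le_norm_self _).trans h
  linarith

/-- Stability of minimizers of strongly convex regularized expectations with respect to the
transport cost between the underlying distributions. -/
lemma norm_minimizer_sub_le_of_coupling {E Y : Type*} [NormedAddCommGroup E]
    [InnerProductSpace ℝ E] [CompleteSpace E] [SeminormedAddCommGroup Y] [MeasurableSpace Y]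
    {ℓ : E → Y → ℝ} {m c : ℝ} (hm : 0 < m) {K : NNReal} {P Q : Measure Y}
    [IsProbabilityMeasure P] [IsProbabilityMeasure Q]
    (hdiff : ∀ y, Differentiable ℝ fun x => ℓ x y)
    (hsc : ∀ y, StrongConvexOn Set.univ m fun x => ℓ x y)
    (hlip : ∀ x, LipschitzWith K fun y => gradient (fun z => ℓ z y) x)
    (hP : ∀ x, Integrable (ℓ x) P) (hQ : ∀ x, Integrable (ℓ x) Q)
    {ψ : E → ℝ} (hψ : ConvexOn ℝ Set.univ ψ) {a b : E}
    (ha : ∀ x, (∫ y, ℓ a y ∂P) + ψ a ≤ (∫ y, ℓ x y ∂P) + ψ x)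
    (hb : ∀ x, (∫ y, ℓ b y ∂Q) + ψ b ≤ (∫ y, ℓ x y ∂Q) + ψ x)
    {π : Measure (Y × Y)} (hfst : π.map Prod.fst = P) (hsnd : π.map Prod.snd = Q)
    (hπ : Integrable (fun p => ‖p.1 - p.2‖) π) (hc : ∫ p, ‖p.1 - p.2‖ ∂π ≤ c) (hc₀ : 0 ≤ c) :
    ‖a - b‖ ≤ K / m * c := by
  subst hfst hsnd
  have hga := StrongConvexOn.add_sq_norm_le_of_forall_le
    (StrongConvexOn.add_convexOn (StrongConvexOn.integral hsc hP) hψ) ha b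
  have hgb := StrongConvexOn.add_sq_norm_le_of_forall_le
    (StrongConvexOn.add_convexOn (StrongConvexOn.integral hsc hQ) hψ) hb a
  simp only [Pi.add_apply] at hga hgb
  rw [norm_sub_rev b a] at hgb
  have h₁ := (hP b).sub (hP a)
  have h₂ := (hQ b).sub (hQ a)
  have hD₁ : Integrable (fun p : Y × Y => ℓ b p.1 - ℓ a p.1) π :=
    h₁.comp_measurable measurable_fst
  have hD₂ : Integrable (fun p : Y × Y => ℓ b p.2 - ℓ a p.2) π :=
    h₂.comp_measurable measurable_snd
  have e₁ := integral_map measurable_fst.aemeasurable h₁.aestronglyMeasurable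
  have e₂ := integral_map measurable_snd.aemeasurable h₂.aestronglyMeasurable
  simp only [Pi.sub_apply] at e₁ e₂
  rw [integral_sub (hP b) (hP a)] at e₁
  rw [integral_sub (hQ b) (hQ a)] at e₂
  have hmono := integral_mono (hD₁.sub hD₂) (hπ.const_mul (K * ‖b - a‖))
    fun p => sub_sub_sub_le_of_lipschitz_gradient hdiff hlip a b p.1 p.2
  simp only [Pi.sub_apply] at hmono
  rw [integral_sub hD₁ hD₂, integral_const_mul, norm_sub_rev b a] at hmono
  have hcost := mul_le_mul_of_nonneg_left hc (mul_nonneg K.coe_nonneg (norm_nonneg (a - b)))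
  have hquad : m * ‖a - b‖ ^ 2 ≤ K * ‖a - b‖ * c := by linarith
  rcases (norm_nonneg (a - b)).eq_or_lt with h0 | hpos
  · rw [← h0]; positivity
  · rw [div_mul_eq_mul_div, le_div_iff₀ hm]
    refine le_of_mul_le_mul_left ?_ hpos
    linarith

/-- Abel summation: the deviation of an affine combination of past terms from the current one,
written through consecutive increments. -/
lemma sum_smul_sub_eq_sum_tail_smul {E : Type*} [AddCommGroup E] [Module ℝ E] (x : ℕ → E)
    (α : ℕ → ℝ) {n : ℕ} (hα : ∑ i ∈ Finset.Icc 1 n, α i = 1) (k : ℕ) :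
    (∑ i ∈ Finset.Icc 1 n, α i • x (k - i)) - x k
      = ∑ j ∈ Finset.Icc 1 n, (∑ i ∈ Finset.Icc j n, α i) • (x (k - j) - x (k - (j - 1))) := by
  have tele : ∀ i, ∑ j ∈ Finset.Icc 1 i, (x (k - j) - x (k - (j - 1))) = x (k - i) - x k := by
    intro i
    induction i with
    | zero => simp
    | succ i ih => rw [Finset.sum_Icc_succ_top (by omega), ih]; simp
  calc (∑ i ∈ Finset.Icc 1 n, α i • x (k - i)) - x k
      = ∑ i ∈ Finset.Icc 1 n, α i • (x (k - i) - x k) := by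
        simp only [smul_sub, Finset.sum_sub_distrib, ← Finset.sum_smul, hα, one_smul]
    _ = ∑ i ∈ Finset.Icc 1 n, ∑ j ∈ Finset.Icc 1 i, α i • (x (k - j) - x (k - (j - 1))) := by
        simp only [← Finset.smul_sum, tele]
    _ = ∑ j ∈ Finset.Icc 1 n, ∑ i ∈ Finset.Icc j n, α i • (x (k - j) - x (k - (j - 1))) :=
        Finset.sum_comm' fun i j => by simp only [Finset.mem_Icc]; omega
    _ = _ := by simp only [Finset.sum_smul]

/-- Bound on the prediction error of the combination `∑ αᵢ x*_{k−i}` under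
`ε`-sensitivity of the distributions: for each `k` there is a coupling of `P_k` and
`P_{k+1}` with transport cost at most `εh`, and then for every `k ≥ n`,
`‖∑_{i=1}^n αᵢ x*_{k−i} − x*_k‖ ≤ (L₁₁/μ) εh ∑_{j=1}^n |∑_{i=j}^n αᵢ|`. -/
theorem prediction_error_sensitive (d dy n : ℕ) (hn : 1 ≤ n)
    (μ : ℝ) (hμ : 0 < μ) (L L₁₁ : NNReal) (ε h : ℝ) (hε : 0 ≤ ε) (hh : 0 < h)
    (P : ℕ → Measure (EuclideanSpace ℝ (Fin dy)))
    (hP : ∀ k, IsProbabilityMeasure (P k))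
    (ℓ : EuclideanSpace ℝ (Fin d) → EuclideanSpace ℝ (Fin dy) → ℝ)
    (hmeas : Measurable fun p : EuclideanSpace ℝ (Fin d) × EuclideanSpace ℝ (Fin dy) =>
      ℓ p.1 p.2)
    (hdiff : ∀ y, Differentiable ℝ fun x => ℓ x y)
    (hsc : ∀ y, ∀ x x' : EuclideanSpace ℝ (Fin d),
      ℓ x' y + ⟪gradient (fun z => ℓ z y) x', x - x'⟫ + μ / 2 * ‖x - x'‖ ^ 2 ≤ ℓ x y)
    (hlipx : ∀ y, LipschitzWith L fun x => gradient (fun z => ℓ z y) x)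
    (hlipy : ∀ x : EuclideanSpace ℝ (Fin d),
      LipschitzWith L₁₁ fun y => gradient (fun z => ℓ z y) x)
    (hint : ∀ x, ∀ k, Integrable (fun y => ℓ x y) (P k))
    (hintg : ∀ x, ∀ k, Integrable (fun y => ‖gradient (fun z => ℓ z y) x‖) (P k))
    (ψ : EuclideanSpace ℝ (Fin d) → ℝ) (hψ : ConvexOn ℝ Set.univ ψ)
    (xstar : ℕ → EuclideanSpace ℝ (Fin d))
    (hxstar : ∀ k, ∀ x,
      (∫ y, ℓ (xstar k) y ∂(P k)) + ψ (xstar k) ≤ (∫ y, ℓ x y ∂(P k)) + ψ x)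
    (α : ℕ → ℝ) (hα : ∑ i ∈ Finset.Icc 1 n, α i = 1)
    (hsens : ∀ k, ∃ π : Measure
        (EuclideanSpace ℝ (Fin dy) × EuclideanSpace ℝ (Fin dy)),
      IsProbabilityMeasure π ∧
      π.map Prod.fst = P k ∧ π.map Prod.snd = P (k + 1) ∧
      Integrable (fun p => ‖p.1 - p.2‖) π ∧
      (∫ p, ‖p.1 - p.2‖ ∂π) ≤ ε * h) :
    ∀ k, n ≤ k →
      ‖(∑ i ∈ Finset.Icc 1 n, α i • xstar (k - i)) - xstar k‖
        ≤ (L₁₁ / μ) * ε * h * ∑ j ∈ Finset.Icc 1 n, |∑ i ∈ Finset.Icc j n, α i| := by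
  intro k hk
  have hstep : ∀ k, ‖xstar k - xstar (k + 1)‖ ≤ L₁₁ / μ * (ε * h) := by
    intro k
    obtain ⟨π, -, hfst, hsnd, hπ, hcost⟩ := hsens k
    have := hP k
    have := hP (k + 1)
    exact norm_minimizer_sub_le_of_coupling hμ hdiff
      (fun y => strongConvexOn_of_gradient_le (hsc y)) hlipy (fun x => hint x k)
      (fun x => hint x (k + 1)) hψ (hxstar k) (hxstar (k + 1)) hfst hsnd hπ hcost (by positivity)
  rw [sum_smul_sub_eq_sum_tail_smul xstar α hα k, Finset.mul_sum]
  refine norm_sum_le_of_le _ fun j hj => ?_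
  rw [Finset.mem_Icc] at hj
  have hj' := hstep (k - j)
  rw [show k - j + 1 = k - (j - 1) by omega] at hj'
  rw [norm_smul, Real.norm_eq_abs, mul_comm, mul_assoc (L₁₁ / μ : ℝ)]
  gcongr
end

section
/- Let 1 ≤ q ≤ p, h > 0, and let x* : ℝ → ℝ^d be q-times differentiable with ‖(x*)^{(q)}(t)‖ ≤ B for all t ≥ 0. Then for every integer k ≥ n, ‖∑_{i=1}^n αᵢ x*((k−i)h) − x*(kh)‖ ≤ ‖α‖₁ · C(n,q) · h^q · B, where C(n,q) is the binomial coefficient n choose q and ‖α‖₁ = ∑_{i=1}^n |αᵢ|. -/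
open Finset in
/-- Newton's forward-difference expansion up to order `q`, with a bound on the remainder. -/
theorem norm_sub_sum_choose_smul_fwdDiff_iter_le {E : Type*} [NormedAddCommGroup E]
    [NormedSpace ℝ E] (q i : ℕ) (y : ℕ → E) (C : ℝ)
    (hy : ∀ s, s + q ≤ i → ‖(fwdDiff 1)^[q] y s‖ ≤ C) :
    ‖y i - ∑ j ∈ range q, (i.choose j : ℝ) • (fwdDiff 1)^[j] y 0‖ ≤ i.choose q * C := by
  induction q generalizing i y with
  | zero => simpa using hy i le_rfl
  | succ q ih =>
    induction i with
    | zero => simp [sum_range_succ']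
    | succ i ihi =>
      have h₁ := ihi fun s hs => hy s (by omega)
      have h₂ := ih i (fwdDiff 1 y) fun s hs => by
        simpa only [Function.iterate_succ_apply] using hy s (by omega)
      have key : y (i + 1) - ∑ j ∈ range (q + 1), ((i + 1).choose j : ℝ) • (fwdDiff 1)^[j] y 0
          = (y i - ∑ j ∈ range (q + 1), (i.choose j : ℝ) • (fwdDiff 1)^[j] y 0)
            + (fwdDiff 1 y i
              - ∑ j ∈ range q, (i.choose j : ℝ) • (fwdDiff 1)^[j] (fwdDiff 1 y) 0) := by
        simp only [sum_range_succ' _ q, Nat.choose_succ_succ, Nat.cast_add, add_smul,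
          sum_add_distrib, Function.iterate_succ_apply, Nat.choose_zero_right, fwdDiff]
        abel
      rw [key, Nat.choose_succ_succ, Nat.cast_add, add_mul, add_comm (_ * C)]
      exact (norm_add_le _ _).trans (by linarith)

/-- A bound on the `q`-th derivative bounds the `q`-th backward difference. Successive derivatives
are given as a sequence `F`. -/
theorem norm_fwdDiff_neg_iter_le {E : Type*} [NormedAddCommGroup E] [NormedSpace ℝ E]
    {h : ℝ} (hh : 0 ≤ h) (q : ℕ) (F : ℕ → ℝ → E) (c B : ℝ)
    (hF : ∀ i < q, ∀ t, HasDerivAt (F i) (F (i + 1) t) t)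
    (hB : ∀ t, c ≤ t → ‖F q t‖ ≤ B) (t : ℝ) (ht : c + q * h ≤ t) :
    ‖(fwdDiff (-h))^[q] (F 0) t‖ ≤ h ^ q * B := by
  induction q generalizing F c B with
  | zero => simpa using hB t (by simpa using ht)
  | succ q ih =>
    rw [Function.iterate_succ_apply, pow_succ, mul_assoc]
    refine ih (fun i => fwdDiff (-h) (F i)) (c + h) (h * B) (fun i hi s => ?_) (fun s hs => ?_) ?_
    · exact ((hF i (by omega) (s + -h)).comp_add_const s (-h)).sub (hF i (by omega) s)
    · have := (convex_Ici c).norm_image_sub_le_of_norm_hasDerivWithin_le (f := F q)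
        (fun x _ => (hF q q.lt_succ_self x).hasDerivWithinAt) (fun x hx => hB x hx)
        (x := s) (y := s + -h) (Set.mem_Ici.2 (by linarith)) (Set.mem_Ici.2 (by linarith))
      simpa [fwdDiff, abs_of_nonneg hh, mul_comm] using this
    · push_cast at ht
      linarith

theorem fwdDiff_one_iter_comp_mul {E : Type*} [AddCommGroup E] (f : ℝ → E) (a h : ℝ) (q s : ℕ) :
    (fwdDiff 1)^[q] (fun i : ℕ => f (a + i * h)) s = (fwdDiff h)^[q] f (a + s * h) := by
  induction q generalizing f with
  | zero => rfl
  | succ q ih =>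
    rw [Function.iterate_succ_apply, Function.iterate_succ_apply, ← ih]
    refine congrFun (congrArg _ ?_) s
    funext i
    simp [fwdDiff, add_mul, add_assoc]

open Finset in
/-- Polynomial regression weights at `1, …, n` extrapolate powers below `p` exactly to `0`. -/
theorem sum_regression_mul_pow {n p : ℕ} (hp : 0 < p) (M : Matrix (Fin p) (Fin p) ℝ)
    (hM : ∀ l m : Fin p, M l m = ∑ j ∈ Icc 1 n, (j : ℝ) ^ ((l : ℕ) + (m : ℕ)))
    (hMinv : IsUnit M.det) (α : ℕ → ℝ)
    (hα : ∀ i ∈ Icc 1 n, α i = ∑ j : Fin p, (i : ℝ) ^ (j : ℕ) * M⁻¹ j ⟨0, hp⟩)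
    {m : ℕ} (hm : m < p) :
    ∑ i ∈ Icc 1 n, α i * (i : ℝ) ^ m = 0 ^ m := by
  have h := congrFun (congrFun (Matrix.mul_nonsing_inv M hMinv) ⟨m, hm⟩) ⟨0, hp⟩
  simp only [Matrix.mul_apply, Matrix.one_apply, Fin.mk.injEq, hM, sum_mul] at h
  rw [sum_comm] at h
  rw [zero_pow_eq, ← h]
  refine sum_congr rfl fun i hi => ?_
  rw [hα i hi, sum_mul]
  exact sum_congr rfl fun j _ => by rw [pow_add]; ring

open Finset in
/-- Weights reproducing powers below `p` at `0` also reproduce binomial coefficients. -/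
theorem sum_mul_choose_of_sum_mul_pow {s : Finset ℕ} {p : ℕ} {α : ℕ → ℝ}
    (hα : ∀ m < p, ∑ i ∈ s, α i * (i : ℝ) ^ m = 0 ^ m) {j : ℕ} (hj : j < p) :
    ∑ i ∈ s, α i * (i.choose j : ℝ) = if j = 0 then 1 else 0 := by
  have hpoly : ∑ i ∈ s, α i * (descPochhammer ℝ j).eval (i : ℝ)
      = (descPochhammer ℝ j).eval 0 := by
    have hdeg : (descPochhammer ℝ j).natDegree < p := by rwa [descPochhammer_natDegree]
    simp only [Polynomial.eval_eq_sum_range' hdeg, mul_sum]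
    rw [sum_comm]
    refine sum_congr rfl fun m hm => ?_
    rw [← hα m (mem_range.1 hm), mul_sum]
    exact sum_congr rfl fun i _ => by ring
  rw [descPochhammer_eval_zero] at hpoly
  simp only [descPochhammer_eval_eq_descFactorial, Nat.descFactorial_eq_factorial_mul_choose,
    Nat.cast_mul, mul_left_comm (α _), ← mul_sum] at hpoly
  have hfac : (j.factorial : ℝ) ≠ 0 := by exact_mod_cast j.factorial_ne_zero
  refine mul_left_cancel₀ hfac (hpoly.trans ?_)
  split_ifs with h0 <;> simp [h0]

/-- Prediction-error bound for polynomial regression coefficients: if the solution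
trajectory `x*` is `q`-times differentiable with `‖(x*)⁽q⁾(t)‖ ≤ B` for `t ≥ 0`, and
`α` is the degree-`(p−1)` polynomial regression coefficient vector built from the
moment matrix `M` (assumed invertible), then for every `k ≥ n`,
`‖∑_{i=1}^n αᵢ x*((k−i)h) − x*(kh)‖ ≤ ‖α‖₁ · C(n,q) · h^q · B`. -/
theorem polynomial_regression_prediction_error (d n p q : ℕ)
    (hq : 1 ≤ q) (hqp : q ≤ p) (hpn : p ≤ n)
    (M : Matrix (Fin p) (Fin p) ℝ)
    (hM : ∀ l m : Fin p, M l m = ∑ j ∈ Finset.Icc 1 n, (j : ℝ) ^ ((l : ℕ) + (m : ℕ)))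
    (hMinv : IsUnit M.det)
    (α : ℕ → ℝ)
    (hα : ∀ i ∈ Finset.Icc 1 n, α i = ∑ j : Fin p, (i : ℝ) ^ (j : ℕ) * M⁻¹ j ⟨0, by omega⟩)
    (h : ℝ) (hh : 0 < h) (B : ℝ)
    (xstar : ℝ → EuclideanSpace ℝ (Fin d))
    (hdiff : ∀ i < q, Differentiable ℝ (iteratedDeriv i xstar))
    (hbound : ∀ t : ℝ, 0 ≤ t → ‖iteratedDeriv q xstar t‖ ≤ B) :
    ∀ k : ℕ, n ≤ k →
      ‖(∑ i ∈ Finset.Icc 1 n, α i • xstar (((k : ℝ) - (i : ℝ)) * h)) - xstar (k * h)‖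
        ≤ (∑ i ∈ Finset.Icc 1 n, |α i|) * (n.choose q : ℝ) * h ^ q * B := by
  intro k hnk
  have hB : 0 ≤ B := (norm_nonneg _).trans (hbound 0 le_rfl)
  set y : ℕ → EuclideanSpace ℝ (Fin d) := fun i => xstar (k * h + i * -h) with hy
  have hmom : ∀ j < q, ∑ i ∈ Finset.Icc 1 n, α i * (i.choose j : ℝ) = if j = 0 then 1 else 0 :=
    fun j hj => sum_mul_choose_of_sum_mul_pow
      (fun m hm => sum_regression_mul_pow (by omega) M hM hMinv α hα hm) (hj.trans_le hqp)
  have hrem : ∀ i ∈ Finset.Icc 1 n,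
      ‖y i - ∑ j ∈ Finset.range q, (i.choose j : ℝ) • (fwdDiff 1)^[j] y 0‖
        ≤ n.choose q * (h ^ q * B) := by
    intro i hi
    have hin := (Finset.mem_Icc.1 hi).2
    refine (norm_sub_sum_choose_smul_fwdDiff_iter_le q i y (h ^ q * B) fun s hs => ?_).trans ?_
    · rw [hy, fwdDiff_one_iter_comp_mul]
      refine norm_fwdDiff_neg_iter_le hh.le q (fun m => iteratedDeriv m xstar) 0 B
        (fun m hm t => ?_) hbound _ ?_
      · simpa only [iteratedDeriv_succ] using (hdiff m hm t).hasDerivAt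
      · have hsk : (s : ℝ) + q ≤ k := by exact_mod_cast hs.trans (hin.trans hnk)
        nlinarith
    · gcongr
  have hexp : ∑ i ∈ Finset.Icc 1 n,
      α i • ∑ j ∈ Finset.range q, (i.choose j : ℝ) • (fwdDiff 1)^[j] y 0 = y 0 := by
    simp only [Finset.smul_sum, smul_smul]
    rw [Finset.sum_comm]
    simp only [← Finset.sum_smul]
    rw [Finset.sum_congr rfl fun j hj => by rw [hmom j (Finset.mem_range.1 hj)]]
    simp [ite_smul, Nat.pos_iff_ne_zero.1 hq]
  have herr : (∑ i ∈ Finset.Icc 1 n, α i • xstar (((k : ℝ) - (i : ℝ)) * h)) - xstar (k * h)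
      = ∑ i ∈ Finset.Icc 1 n,
        α i • (y i - ∑ j ∈ Finset.range q, (i.choose j : ℝ) • (fwdDiff 1)^[j] y 0) := by
    simp only [smul_sub, Finset.sum_sub_distrib, hexp]
    simp [hy, sub_eq_add_neg, add_mul]
  rw [herr, mul_assoc, mul_assoc, Finset.sum_mul]
  refine norm_sum_le_of_le _ fun i hi => ?_
  rw [norm_smul, Real.norm_eq_abs]
  exact mul_le_mul_of_nonneg_left (hrem i hi) (abs_nonneg _)
end

section
/- Let 1 ≤ p ≤ n be integers and α ∈ ℝⁿ satisfy the moment conditions ∑_{i=1}^n αᵢ i^m = 1 if m = 0 and ∑_{i=1}^n αᵢ i^m = 0 for m = 1,…,p−1. Then the polynomial P(X) := ∑_{i=1}^n αᵢ X^{n−i} − X^n ∈ ℝ[X] is divisible by (X − 1)^p; equivalently, P^{(j)}(1) = 0 for all j = 0,…,p−1. -/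
open Polynomial

/-- Weights whose moments of order `< p` agree with those of the point mass at `0` integrate
polynomials of degree `< p` exactly as evaluation at `0`. -/
theorem sum_mul_eval_eq_eval_zero_of_moments {R ι : Type*} [CommSemiring R] {p : ℕ}
    (s : Finset ι) (w x : ι → R)
    (hmom : ∀ m < p, ∑ i ∈ s, w i * x i ^ m = if m = 0 then 1 else 0)
    {q : R[X]} (hq : q.natDegree < p) :
    ∑ i ∈ s, w i * q.eval (x i) = q.eval 0 := by
  simp_rw [eval_eq_sum_range' hq, Finset.mul_sum]
  rw [Finset.sum_comm]
  refine Finset.sum_congr rfl fun m hm => ?_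
  simp_rw [mul_left_comm (w _)]
  rw [← Finset.mul_sum, hmom m (Finset.mem_range.mp hm), zero_pow_eq]

theorem eval_one_iterate_derivative_X_pow {R : Type*} [CommRing R] (k j : ℕ) :
    (derivative^[j] (X ^ k : R[X])).eval 1 = (descPochhammer R j).eval (k : R) := by
  rw [iterate_derivative_X_pow_eq_natCast_mul, descPochhammer_eval_eq_descFactorial]
  simp

theorem X_sub_C_pow_dvd_of_iterate_derivative_eval_eq_zero {K : Type*} [Field K] [CharZero K]
    {f : K[X]} {a : K} {p : ℕ} (h : ∀ j < p, (derivative^[j] f).eval a = 0) :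
    (X - C a) ^ p ∣ f := by
  rcases eq_or_ne f 0 with rfl | hf
  · exact dvd_zero _
  rcases p with _ | p
  · simp
  rw [← le_rootMultiplicity_iff hf, Nat.succ_le_iff,
    lt_rootMultiplicity_iff_isRoot_iterate_derivative hf]
  exact fun m hm => h m (Nat.lt_succ_of_le hm)

/-- If `α ∈ ℝⁿ` satisfies the moment conditions `∑ αᵢ i^m = [m = 0]` for
`m = 0, …, p−1`, then the polynomial `P(X) = ∑_{i=1}^n αᵢ X^{n−i} − X^n` is
divisible by `(X − 1)^p`; equivalently, `P⁽ʲ⁾(1) = 0` for `j = 0, …, p−1`. -/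
theorem moment_conditions_root_multiplicity (n p : ℕ) (hp : 1 ≤ p) (hpn : p ≤ n)
    (α : ℕ → ℝ)
    (hmom : ∀ m < p, ∑ i ∈ Finset.Icc 1 n, α i * (i : ℝ) ^ m
      = if m = 0 then 1 else 0) :
    (X - 1 : ℝ[X]) ^ p ∣
        (∑ i ∈ Finset.Icc 1 n, C (α i) * X ^ (n - i) - X ^ n) ∧
      ∀ j < p, (derivative^[j]
        (∑ i ∈ Finset.Icc 1 n, C (α i) * X ^ (n - i) - X ^ n : ℝ[X])).eval 1 = 0 := by
  have hderiv : ∀ j < p, (derivative^[j]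
      (∑ i ∈ Finset.Icc 1 n, C (α i) * X ^ (n - i) - X ^ n : ℝ[X])).eval 1 = 0 := by
    intro j hj
    have hdeg : ((descPochhammer ℝ j).comp (C (n : ℝ) - X)).natDegree < p := by
      rw [natDegree_comp, descPochhammer_natDegree, natDegree_sub, natDegree_X_sub_C, mul_one]
      exact hj
    have key := sum_mul_eval_eq_eval_zero_of_moments _ α (fun i => (i : ℝ)) hmom hdeg
    simp only [eval_comp, eval_sub, eval_C, eval_X, sub_zero] at key
    rw [iterate_derivative_sub, iterate_derivative_sum, eval_sub, eval_finsetSum,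
      eval_one_iterate_derivative_X_pow, ← key, sub_eq_zero]
    refine Finset.sum_congr rfl fun i hi => ?_
    rw [iterate_derivative_C_mul, eval_C_mul, eval_one_iterate_derivative_X_pow,
      Nat.cast_sub (Finset.mem_Icc.mp hi).2]
  refine ⟨?_, hderiv⟩
  simpa only [C_1] using X_sub_C_pow_dvd_of_iterate_derivative_eval_eq_zero hderiv
end

section
/- Let 1 ≤ q ≤ p ≤ n be integers and α ∈ ℝⁿ satisfy the moment conditions ∑_{i=1}^n αᵢ i^m = 1 if m = 0 and ∑_{i=1}^n αᵢ i^m = 0 for m = 1,…,p−1, so that P(X) := ∑_{i=1}^n αᵢ X^{n−i} − X^n factors as P(X) = (1 − X)^q Q(X) with Q(X) = ∑_{i=0}^{n−q} bᵢ X^i ∈ ℝ[X]. Then for each i = 0,…,n−q, bᵢ = ∑_{l=0}^{i} C(q+l−1, q−1) α_{n−i+l}, and ∑_{i=0}^{n−q} |bᵢ| ≤ C(n,q) ‖α‖₁, where C(·,·) denotes binomial coefficients and ‖α‖₁ = ∑_{i=1}^n |αᵢ|. -/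
open Polynomial

/-- Dividing by `(1 - X) ^ (d + 1)` convolves the coefficients with `k ↦ (d + k).choose d`. -/
theorem coeff_eq_of_one_sub_X_pow_mul {R : Type*} [CommRing R] {P Q : R[X]} {d : ℕ}
    (h : P = (1 - X) ^ (d + 1) * Q) (i : ℕ) :
    Q.coeff i = ∑ a ∈ Finset.HasAntidiagonal.antidiagonal i, P.coeff a.1 * ((d + a.2).choose d : R) := by
  have hinv : (P : PowerSeries R) * PowerSeries.mk (fun k => ((d + k).choose d : R)) = Q := by
    rw [h, coe_mul, mul_right_comm, coe_pow, coe_sub, coe_one, coe_X, mul_comm (_ ^ _),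
      PowerSeries.mk_add_choose_mul_one_sub_pow_eq_one, one_mul]
  rw [← coeff_coe, ← hinv, PowerSeries.coeff_mul]
  simp

/-- If `α` satisfies the moment conditions and `P(X) = ∑ αᵢ X^{n−i} − X^n` factors as
`(1−X)^q · Q(X)` with `Q(X) = ∑_{i=0}^{n−q} bᵢ Xⁱ`, then
`bᵢ = ∑_{l=0}^{i} C(q+l−1, q−1) α_{n−i+l}` and `∑ |bᵢ| ≤ C(n,q) ‖α‖₁`. -/
theorem factorization_coefficients (n p q : ℕ) (hq : 1 ≤ q) (hqp : q ≤ p) (hpn : p ≤ n)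
    (α : ℕ → ℝ)
    (hmom : ∀ m < p, ∑ i ∈ Finset.Icc 1 n, α i * (i : ℝ) ^ m
      = if m = 0 then 1 else 0)
    (b : ℕ → ℝ)
    (hfact : (∑ i ∈ Finset.Icc 1 n, C (α i) * X ^ (n - i) - X ^ n : ℝ[X])
      = (1 - X) ^ q * ∑ i ∈ Finset.range (n - q + 1), C (b i) * X ^ i) :
    (∀ i ≤ n - q,
        b i = ∑ l ∈ Finset.range (i + 1),
          ((q + l - 1).choose (q - 1) : ℝ) * α (n - i + l)) ∧
      ∑ i ∈ Finset.range (n - q + 1), |b i|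
        ≤ (n.choose q : ℝ) * ∑ i ∈ Finset.Icc 1 n, |α i| := by
  obtain ⟨d, rfl⟩ : ∃ d, q = d + 1 := ⟨q - 1, by omega⟩
  have hcoeff : ∀ i ≤ n - (d + 1), b i = ∑ j ∈ Finset.range (i + 1),
      α (n - j) * ((d + (i - j)).choose d : ℝ) := by
    intro i hi
    have hQ : (∑ i ∈ Finset.range (n - (d + 1) + 1), C (b i) * X ^ i : ℝ[X]).coeff i = b i := by
      simp only [finsetSum_coeff, coeff_C_mul_X_pow, Finset.sum_ite_eq, Finset.mem_range]
      rw [if_pos (by omega)]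
    rw [← hQ, coeff_eq_of_one_sub_X_pow_mul hfact, Finset.Nat.sum_antidiagonal_eq_sum_range_succ
      (fun a c => coeff _ a * ((d + c).choose d : ℝ))]
    refine Finset.sum_congr rfl fun j hj => ?_
    have hj' : j < n := by simp at hj; omega
    congr 1
    simp only [coeff_sub, finsetSum_coeff, coeff_C_mul_X_pow, coeff_X_pow, hj'.ne, if_false,
      sub_zero]
    rw [Finset.sum_eq_single (n - j)]
    · rw [if_pos (by omega)]
    · intro k hk hkj
      simp at hk
      exact if_neg (by omega)
    · intro h
      simp at h
      omega
  refine ⟨fun i hi => ?_, ?_⟩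
  · rw [hcoeff i hi, ← Finset.sum_range_reflect]
    refine Finset.sum_congr rfl fun l hl => ?_
    have hl' : l ≤ i := by simpa [Nat.lt_succ_iff] using hl
    rw [mul_comm]
    congr 3 <;> omega
  · calc
      ∑ i ∈ Finset.range (n - (d + 1) + 1), |b i|
        ≤ ∑ i ∈ Finset.range (n - (d + 1) + 1), ∑ j ∈ Finset.range (i + 1),
            |α (n - j)| * ((d + (i - j)).choose d : ℝ) := by
          refine Finset.sum_le_sum fun i hi => ?_
          rw [hcoeff i (by simp at hi; omega)]
          refine (Finset.abs_sum_le_sum_abs _ _).trans_eq ?_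
          simp [abs_mul]
      _ = ∑ j ∈ Finset.range (n - d), |α (n - j)| * ((n - j).choose (d + 1) : ℝ) := by
          rw [show n - (d + 1) + 1 = n - d by omega, Finset.sum_range_diag_flip _
            (fun j c => |α (n - j)| * ((d + c).choose d : ℝ))]
          refine Finset.sum_congr rfl fun j hj => ?_
          have hj' : j < n - d := by simpa using hj
          rw [← Finset.mul_sum, ← Nat.cast_sum]
          congr 2
          obtain ⟨m, hm⟩ : ∃ m, n - d - j = m + 1 := ⟨n - d - j - 1, by omega⟩
          simp only [hm, add_comm d]
          rw [Nat.sum_range_add_choose]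
          congr 1 <;> omega
      _ ≤ ∑ j ∈ Finset.range n, |α (n - j)| * (n.choose (d + 1) : ℝ) := by
          refine (Finset.sum_le_sum fun j _ => ?_).trans
            (Finset.sum_le_sum_of_subset_of_nonneg
              (Finset.range_subset_range.2 (Nat.sub_le n d)) fun _ _ _ => by positivity)
          gcongr
          exact Nat.sub_le n j
      _ = (n.choose (d + 1) : ℝ) * ∑ i ∈ Finset.Icc 1 n, |α i| := by
          rw [← Finset.sum_mul, mul_comm]
          congr 1
          refine Finset.sum_nbij' (fun j => n - j) (fun j => n - j) ?_ ?_ ?_ ?_ ?_ <;>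
            intro j hj <;> simp at hj ⊢ <;> omega
end

section
/- Fix an integer p ≥ 1. For each integer n ≥ p, the matrix M(n) ∈ ℝ^{p×p} with entries M(n)_{l,m} = ∑_{j=1}^n j^{l+m−2} (l,m = 1,…,p) is invertible; let α(n) ∈ ℝⁿ be defined by α(n)ᵢ = ∑_{j=1}^p i^{j−1} (M(n)⁻¹)_{j,1} for i = 1,…,n. Then, as n → ∞, the Euclidean norm satisfies ‖α(n)‖₂ = O(1/√n) (i.e., √n · ‖α(n)‖₂ is bounded), and the ℓ¹-norm satisfies ‖α(n)‖₁ = ∑_{i=1}^n |α(n)ᵢ| = O(1) (i.e., bounded as n → ∞). -/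
/-- The `p×p` moment matrix of degree-`(p−1)` polynomial regression on the
nodes `1, …, n`: `M(n)_{l,m} = ∑_{j=1}^n j^{l+m−2}` (here `0`-indexed). -/
def momentMatrix (p n : ℕ) : Matrix (Fin p) (Fin p) ℝ :=
  Matrix.of fun l m : Fin p => ∑ j ∈ Finset.Icc 1 n, (j : ℝ) ^ ((l : ℕ) + (m : ℕ))

/-- The polynomial-regression coefficient `α(n)ᵢ = ∑_{j=1}^p i^{j−1} (M(n)⁻¹)_{j,1}`. -/
noncomputable def regCoeff (p n : ℕ) (hp : 1 ≤ p) (i : ℕ) : ℝ :=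
  ∑ j : Fin p, (i : ℝ) ^ (j : ℕ) * (momentMatrix p n)⁻¹ j ⟨0, hp⟩

open Matrix in
/-- The quadratic form of the moment matrix is the sum of squared values of the polynomial with
coefficients `v` over the nodes. -/
lemma dotProduct_momentMatrix_mulVec (p n : ℕ) (v : Fin p → ℝ) :
    v ⬝ᵥ (momentMatrix p n *ᵥ v) =
      ∑ i ∈ Finset.Icc 1 n, (∑ j : Fin p, (i : ℝ) ^ (j : ℕ) * v j) ^ 2 := by
  simp only [dotProduct, mulVec, momentMatrix, of_apply, sq, Finset.sum_mul_sum]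
  rw [Finset.sum_comm]
  refine Finset.sum_congr rfl fun l _ => ?_
  rw [Finset.sum_comm, Finset.mul_sum]
  refine Finset.sum_congr rfl fun m _ => ?_
  rw [Finset.sum_mul, Finset.mul_sum]
  exact Finset.sum_congr rfl fun i _ => by rw [pow_add]; ring

/-- The Vandermonde matrix at the nodes `1, …, p` is nonsingular. -/
lemma det_vandermonde_succ_ne_zero (p : ℕ) :
    (Matrix.vandermonde fun k : Fin p => ((k : ℕ) + 1 : ℝ)).det ≠ 0 := by
  rw [Matrix.det_vandermonde_ne_zero_iff]
  intro a b h
  simpa [Fin.ext_iff] using h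

open Matrix in
lemma isUnit_det_momentMatrix {p n : ℕ} (h : p ≤ n) : IsUnit (momentMatrix p n).det := by
  rw [isUnit_iff_ne_zero]
  intro h0
  obtain ⟨v, hv, hMv⟩ := exists_mulVec_eq_zero_iff.mpr h0
  have hs := dotProduct_momentMatrix_mulVec p n v
  rw [hMv, dotProduct_zero, eq_comm, Finset.sum_eq_zero_iff_of_nonneg fun _ _ => sq_nonneg _] at hs
  refine hv (eq_zero_of_mulVec_eq_zero (det_vandermonde_succ_ne_zero p) ?_)
  ext k
  have hk := hs (k + 1) (Finset.mem_Icc.mpr ⟨by omega, by omega⟩)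
  simpa [mulVec, dotProduct, vandermonde_apply] using hk

open Matrix in
/-- Extrapolation to `0` from the nodes `t, 2t, …, pt` is exact in degree less than `p`, with
weights independent of the step `t`. -/
lemma exists_extrapolation_weights (p : ℕ) (hp : 1 ≤ p) :
    ∃ w : Fin p → ℝ, ∀ (t : ℝ) (v : Fin p → ℝ),
      v ⟨0, hp⟩ = ∑ k : Fin p, w k * ∑ j : Fin p, (((k : ℕ) + 1) * t) ^ (j : ℕ) * v j := by
  set V : Matrix (Fin p) (Fin p) ℝ := vandermonde fun k : Fin p => ((k : ℕ) + 1 : ℝ) with hV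
  have hdet : IsUnit V.det := isUnit_iff_ne_zero.mpr (det_vandermonde_succ_ne_zero p)
  refine ⟨Pi.single ⟨0, hp⟩ 1 ᵥ* V⁻¹, fun t v => ?_⟩
  have hw : (Pi.single ⟨0, hp⟩ 1 ᵥ* V⁻¹) ᵥ* V = Pi.single ⟨0, hp⟩ 1 := by
    rw [vecMul_vecMul, nonsing_inv_mul _ hdet, vecMul_one]
  generalize Pi.single ⟨0, hp⟩ 1 ᵥ* V⁻¹ = w at hw
  have hsum : ∀ j : Fin p, ∑ k : Fin p, w k * ((k : ℕ) + 1 : ℝ) ^ (j : ℕ) =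
      (Pi.single ⟨0, hp⟩ 1 : Fin p → ℝ) j := fun j => by
    rw [← hw]
    simp [vecMul, dotProduct, hV, vandermonde_apply]
  calc v ⟨0, hp⟩ = ∑ j : Fin p, (Pi.single ⟨0, hp⟩ 1 : Fin p → ℝ) j * (t ^ (j : ℕ) * v j) := by
        simp [Pi.single_apply]
    _ = ∑ j : Fin p, ∑ k : Fin p, w k * ((((k : ℕ) + 1) * t) ^ (j : ℕ) * v j) := by
        refine Finset.sum_congr rfl fun j _ => ?_
        rw [← hsum, Finset.sum_mul]
        exact Finset.sum_congr rfl fun k _ => by rw [mul_pow]; ring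
    _ = _ := by rw [Finset.sum_comm]; simp only [Finset.mul_sum]

/-- Restricting a nonnegative sum over `1, …, n` to the multiples of `c` does not increase it. -/
lemma sum_multiples_le_sum {f : ℕ → ℝ} (hf : ∀ i, 0 ≤ f i) {c m n : ℕ} (hc : 0 < c)
    (h : c * m ≤ n) : ∑ t ∈ Finset.Icc 1 m, f (c * t) ≤ ∑ i ∈ Finset.Icc 1 n, f i := by
  rw [← Finset.sum_image (f := f) (g := fun t => c * t)
    fun a _ b _ hab => Nat.eq_of_mul_eq_mul_left hc hab]
  refine Finset.sum_le_sum_of_subset_of_nonneg (fun i hi => ?_) fun i _ _ => hf i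
  obtain ⟨t, ht, rfl⟩ := Finset.mem_image.mp hi
  rw [Finset.mem_Icc] at ht ⊢
  exact ⟨Nat.mul_pos hc ht.1, (Nat.mul_le_mul_left c ht.2).trans h⟩

/-- A polynomial of degree less than `p` has squared value at `0` at most a constant times its mean
square over the nodes `1, …, n`. -/
lemma exists_mul_sq_le_sum_sq (p : ℕ) (hp : 1 ≤ p) :
    ∃ K : ℝ, 0 ≤ K ∧ ∀ n, p ≤ n → ∀ v : Fin p → ℝ,
      n * v ⟨0, hp⟩ ^ 2 ≤
        K * ∑ i ∈ Finset.Icc 1 n, (∑ j : Fin p, (i : ℝ) ^ (j : ℕ) * v j) ^ 2 := by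
  obtain ⟨w, hw⟩ := exists_extrapolation_weights p hp
  set W := ∑ k, w k ^ 2
  have hW : 0 ≤ W := Finset.sum_nonneg fun _ _ => sq_nonneg _
  refine ⟨2 * p * (W * p), by positivity, fun n hn v => ?_⟩
  set f : ℕ → ℝ := fun i => (∑ j : Fin p, (i : ℝ) ^ (j : ℕ) * v j) ^ 2 with hf
  set S := ∑ i ∈ Finset.Icc 1 n, f i
  have hstep (t : ℕ) : v ⟨0, hp⟩ ^ 2 ≤ W * ∑ k : Fin p, f ((k + 1) * t) := by
    rw [hw t v]
    refine (Finset.sum_mul_sq_le_sq_mul_sq _ _ _).trans_eq ?_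
    simp [hf, W]
  have hsum : (n / p : ℕ) * v ⟨0, hp⟩ ^ 2 ≤ W * (p * S) := by
    calc ((n / p : ℕ) : ℝ) * v ⟨0, hp⟩ ^ 2
        = ∑ t ∈ Finset.Icc 1 (n / p), v ⟨0, hp⟩ ^ 2 := by simp
      _ ≤ ∑ t ∈ Finset.Icc 1 (n / p), W * ∑ k : Fin p, f ((k + 1) * t) :=
          Finset.sum_le_sum fun t _ => hstep t
      _ = W * ∑ k : Fin p, ∑ t ∈ Finset.Icc 1 (n / p), f ((k + 1) * t) := by
          rw [← Finset.mul_sum, Finset.sum_comm]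
      _ ≤ W * ∑ _k : Fin p, S := by
          gcongr with k
          exact sum_multiples_le_sum (f := f) (fun i => sq_nonneg _) k.val.succ_pos
            ((Nat.mul_le_mul_right _ k.isLt).trans (Nat.mul_div_le n p))
      _ = W * (p * S) := by simp
  have hn2 : (n : ℝ) ≤ 2 * p * (n / p : ℕ) := by
    have h1 : 1 ≤ n / p := (Nat.one_le_div_iff hp).mpr hn
    have h2 := Nat.div_add_mod n p
    have h3 := Nat.mod_lt n hp
    have : n ≤ 2 * p * (n / p) := by nlinarith
    exact_mod_cast this
  calc (n : ℝ) * v ⟨0, hp⟩ ^ 2 ≤ 2 * p * (n / p : ℕ) * v ⟨0, hp⟩ ^ 2 := by gcongr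
    _ = 2 * p * ((n / p : ℕ) * v ⟨0, hp⟩ ^ 2) := by ring
    _ ≤ 2 * p * (W * (p * S)) := by gcongr
    _ = 2 * p * (W * p) * S := by ring

open Matrix in
lemma sum_regCoeff_sq {p n : ℕ} (hp : 1 ≤ p) (h : p ≤ n) :
    ∑ i ∈ Finset.Icc 1 n, regCoeff p n hp i ^ 2 =
      (momentMatrix p n)⁻¹ ⟨0, hp⟩ ⟨0, hp⟩ := by
  have hc : momentMatrix p n *ᵥ (momentMatrix p n)⁻¹.col ⟨0, hp⟩ = Pi.single ⟨0, hp⟩ 1 := by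
    rw [← mulVec_single_one, mulVec_mulVec, mul_nonsing_inv _ (isUnit_det_momentMatrix h),
      one_mulVec]
  have hs := dotProduct_momentMatrix_mulVec p n ((momentMatrix p n)⁻¹.col ⟨0, hp⟩)
  rw [hc, dotProduct_single_one] at hs
  exact hs.symm

/-- Asymptotics of the polynomial-regression coefficients: for fixed `p ≥ 1` and
`n → ∞`, `M(n)` is invertible, `‖α(n)‖₂ = O(1/√n)` and `‖α(n)‖₁ = O(1)`. -/
theorem regression_coefficient_asymptotics (p : ℕ) (hp : 1 ≤ p) :
    (∀ n, p ≤ n → IsUnit (momentMatrix p n).det) ∧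
    ∃ C : ℝ, ∀ n, p ≤ n →
      Real.sqrt n *
          Real.sqrt (∑ i ∈ Finset.Icc 1 n, (regCoeff p n hp i) ^ 2) ≤ C ∧
      ∑ i ∈ Finset.Icc 1 n, |regCoeff p n hp i| ≤ C := by
  refine ⟨fun n hn => isUnit_det_momentMatrix hn, ?_⟩
  obtain ⟨K, hK0, hK⟩ := exists_mul_sq_le_sum_sq p hp
  refine ⟨√K, fun n hn => ?_⟩
  have hsq := sum_regCoeff_sq hp hn
  have hb : n * (momentMatrix p n)⁻¹ ⟨0, hp⟩ ⟨0, hp⟩ ^ 2 ≤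
      K * ∑ i ∈ Finset.Icc 1 n, regCoeff p n hp i ^ 2 :=
    hK n hn fun j => (momentMatrix p n)⁻¹ j ⟨0, hp⟩
  rw [← hsq] at hb
  have hS : 0 ≤ ∑ i ∈ Finset.Icc 1 n, regCoeff p n hp i ^ 2 :=
    Finset.sum_nonneg fun _ _ => sq_nonneg _
  have hl1 : (∑ i ∈ Finset.Icc 1 n, |regCoeff p n hp i|) ^ 2 ≤
      n * ∑ i ∈ Finset.Icc 1 n, regCoeff p n hp i ^ 2 := by
    simpa using sq_sum_le_card_mul_sum_sq (s := Finset.Icc 1 n)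
      (f := fun i => |regCoeff p n hp i|)
  have hle : n * ∑ i ∈ Finset.Icc 1 n, regCoeff p n hp i ^ 2 ≤ K := by
    rcases hS.eq_or_lt with h0 | hpos
    · rwa [← h0, mul_zero]
    · exact le_of_mul_le_mul_right (by rwa [mul_assoc, ← sq]) hpos
  refine ⟨?_, Real.le_sqrt_of_sq_le (hl1.trans hle)⟩
  rw [← Real.sqrt_mul n.cast_nonneg]
  exact Real.sqrt_le_sqrt hle
end
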